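/- arXiv:2603.07844 — 2 statements merged into one kernel-verified Lean document; each statement's English description precedes it below -/
import Mathlib

section
/- In a deterministic planning problem, define the value-iteration operator T : (X → ℝ≥0∞) → (X → ℝ≥0∞) by (T V) x = 0 if x ∈ G and (T V) x = ⨅ (u : U), ((ℓ x u : ℝ≥0∞) + V (f x u)) if x ∉ G, and let V₀ : X → ℝ≥0∞ be V₀ x = 0 for x ∈ G and V₀ x = ⊤ for x ∉ G. Then for every n ≥ Fintype.card X, the n-fold iterate satisfies T^[n] V₀ = G*; that is, synchronous value iteration converges to the optimal cost-to-go in at most |X| sweeps. -/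
open scoped NNReal ENNReal

variable {X U : Type*}

/-- Trajectory of an action sequence `a` from state `x` under transition function `f`. -/
def traj (f : X → U → X) (x : X) (a : ℕ → U) : ℕ → X
  | 0 => x
  | k + 1 => f (traj f x a k) (a k)

/-- The `K`-stage cost of the action sequence `a` from `x`. -/
def cost (f : X → U → X) (ℓ : X → U → ℝ≥0) (x : X) (a : ℕ → U) (K : ℕ) : ℝ≥0 :=
  ∑ k ∈ Finset.range K, ℓ (traj f x a k) (a k)

/-- The optimal cost-to-go: infimum of cost over all goal-reaching plans (⊤ if none). -/
noncomputable def Gstar (f : X → U → X) (ℓ : X → U → ℝ≥0) (G : Set X) (x : X) : ℝ≥0∞ :=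
  ⨅ (K : ℕ) (a : ℕ → U) (_ : traj f x a K ∈ G), (cost f ℓ x a K : ℝ≥0∞)

open Classical in
/-- The synchronous value-iteration operator. -/
noncomputable def valIter (f : X → U → X) (ℓ : X → U → ℝ≥0) (G : Set X)
    (V : X → ℝ≥0∞) : X → ℝ≥0∞ :=
  fun x => if x ∈ G then 0 else ⨅ (u : U), ((ℓ x u : ℝ≥0∞) + V (f x u))

open Classical in
/-- The initial value function: `0` on the goal, `⊤` elsewhere. -/
noncomputable def Vinit (G : Set X) : X → ℝ≥0∞ :=
  fun x => if x ∈ G then 0 else ⊤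

section Plans

variable (f : X → U → X) (ℓ : X → U → ℝ≥0) (G : Set X)

theorem traj_add (x : X) (a : ℕ → U) (i m : ℕ) :
    traj f x a (i + m) = traj f (traj f x a i) (fun k => a (i + k)) m := by
  induction m with
  | zero => rfl
  | succ m ih => rw [← Nat.add_assoc, traj, traj, ih]

theorem cost_add (x : X) (a : ℕ → U) (i m : ℕ) :
    cost f ℓ x a (i + m) =
      cost f ℓ x a i + cost f ℓ (traj f x a i) (fun k => a (i + k)) m := by
  simp only [cost, Finset.sum_range_add, traj_add]

theorem traj_congr (x : X) {a b : ℕ → U} {n : ℕ} (h : ∀ k < n, a k = b k) :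
    traj f x a n = traj f x b n := by
  induction n with
  | zero => rfl
  | succ n ih => rw [traj, traj, ih fun k hk => h k (by omega), h n (by omega)]

theorem cost_congr (x : X) {a b : ℕ → U} {n : ℕ} (h : ∀ k < n, a k = b k) :
    cost f ℓ x a n = cost f ℓ x b n := by
  refine Finset.sum_congr rfl fun k hk => ?_
  have hk := Finset.mem_range.mp hk
  rw [traj_congr f x fun i hi => h i (hi.trans hk), h k hk]

theorem traj_one_add (x : X) (a : ℕ → U) (m : ℕ) :
    traj f x a (1 + m) = traj f (f x (a 0)) (fun k => a (1 + k)) m :=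
  traj_add f x a 1 m

theorem cost_one_add (x : X) (a : ℕ → U) (m : ℕ) :
    cost f ℓ x a (1 + m) = ℓ x (a 0) + cost f ℓ (f x (a 0)) (fun k => a (1 + k)) m := by
  rw [cost_add]
  simp [cost, traj]

/-- Removing a cycle from a plan keeps its endpoint and does not increase its cost. -/
theorem exists_plan_remove_cycle (x : X) (a : ℕ → U) {i j m : ℕ} (hij : i ≤ j)
    (h : traj f x a i = traj f x a j) :
    ∃ b : ℕ → U, traj f x b (i + m) = traj f x a (j + m) ∧
      cost f ℓ x b (i + m) ≤ cost f ℓ x a (j + m) := by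
  set b : ℕ → U := fun k => if k < i then a k else a (j + (k - i)) with hb
  have hba : ∀ k < i, b k = a k := fun k hk => by simp [hb, hk]
  have hshift : (fun k => b (i + k)) = fun k => a (j + k) := by
    funext k
    simp [hb]
  refine ⟨b, ?_, ?_⟩
  · rw [traj_add, traj_congr f x hba, hshift, h, ← traj_add]
  · rw [cost_add, cost_add, traj_congr f x hba, cost_congr f ℓ x hba, hshift, h]
    gcongr
    exact Finset.sum_le_sum_of_subset (Finset.range_mono hij)

/-- Every endpoint of a plan is reached by a plan of length less than the number of states whose
cost is no larger. -/
theorem exists_plan_lt_card [Fintype X] (x : X) (a : ℕ → U) (K : ℕ) :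
    ∃ (L : ℕ) (b : ℕ → U), L < Fintype.card X ∧ traj f x b L = traj f x a K ∧
      cost f ℓ x b L ≤ cost f ℓ x a K := by
  induction K using Nat.strong_induction_on generalizing a with
  | _ K ih =>
    by_cases hK : K < Fintype.card X
    · exact ⟨K, a, hK, rfl, le_rfl⟩
    obtain ⟨i, j, hij, h⟩ : ∃ i j : Fin (K + 1), i < j ∧ traj f x a i = traj f x a j := by
      obtain ⟨i, j, hne, h⟩ := Fintype.exists_ne_map_eq_of_card_lt
        (fun i : Fin (K + 1) => traj f x a i) (by rw [Fintype.card_fin]; omega)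
      rcases lt_or_gt_of_ne hne with hlt | hlt
      · exact ⟨i, j, hlt, h⟩
      · exact ⟨j, i, hlt, h.symm⟩
    have hij' : (i : ℕ) < j := hij
    obtain ⟨m, hm⟩ := Nat.exists_eq_add_of_le (Nat.lt_succ_iff.mp j.isLt)
    obtain ⟨b, hbt, hbc⟩ := exists_plan_remove_cycle f ℓ x a (m := m) hij'.le h
    obtain ⟨L, c, hL, hct, hcc⟩ := ih (i + m) (by omega) b
    rw [← hm] at hbt hbc
    exact ⟨L, c, hL, hct.trans hbt, hcc.trans hbc⟩

theorem Gstar_le_cost {x : X} {a : ℕ → U} {K : ℕ} (h : traj f x a K ∈ G) :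
    Gstar f ℓ G x ≤ cost f ℓ x a K :=
  iInf_le_of_le K (iInf_le_of_le a (iInf_le _ h))

theorem Gstar_eq_zero [Nonempty U] {x : X} (hx : x ∈ G) : Gstar f ℓ G x = 0 := by
  have h := Gstar_le_cost f ℓ G (x := x) (a := fun _ => Classical.arbitrary U) (K := 0) hx
  simpa [cost] using h

theorem Gstar_le_add (x : X) (u : U) : Gstar f ℓ G x ≤ ℓ x u + Gstar f ℓ G (f x u) := by
  conv_rhs => rw [Gstar]
  simp only [ENNReal.add_iInf]
  refine le_iInf fun K => le_iInf fun a => le_iInf fun h => ?_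
  set b : ℕ → U := fun k => Nat.casesOn k u a
  have hb_zero : b 0 = u := rfl
  have hb : (fun k => b (1 + k)) = a := by
    funext k
    simp [b, Nat.add_comm 1 k]
  have ht : traj f x b (1 + K) = traj f (f x u) a K := by
    rw [traj_one_add, hb, hb_zero]
  have hc : cost f ℓ x b (1 + K) = ℓ x u + cost f ℓ (f x u) a K := by
    rw [cost_one_add, hb, hb_zero]
  have := Gstar_le_cost f ℓ G (x := x) (a := b) (K := 1 + K) (ht ▸ h)
  rwa [hc, ENNReal.coe_add] at this

theorem Gstar_le_iterate [Nonempty U] (n : ℕ) (x : X) :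
    Gstar f ℓ G x ≤ (valIter f ℓ G)^[n] (Vinit G) x := by
  induction n generalizing x with
  | zero =>
    by_cases hx : x ∈ G
    · simp [Gstar_eq_zero f ℓ G hx]
    · simp [Vinit, hx]
  | succ n ih =>
    rw [Function.iterate_succ_apply', valIter]
    split_ifs with hx
    · exact (Gstar_eq_zero f ℓ G hx).le
    · exact le_iInf fun u => (Gstar_le_add f ℓ G x u).trans (add_le_add_right (ih _) _)

theorem iterate_le_cost (n : ℕ) {x : X} {a : ℕ → U} {K : ℕ} (hK : K ≤ n)
    (h : traj f x a K ∈ G) :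
    (valIter f ℓ G)^[n] (Vinit G) x ≤ cost f ℓ x a K := by
  induction n generalizing x a K with
  | zero =>
    obtain rfl : K = 0 := by omega
    have hx : x ∈ G := h
    simp [Vinit, hx]
  | succ n ih =>
    rw [Function.iterate_succ_apply', valIter]
    split_ifs with hx
    · exact zero_le
    · obtain rfl | ⟨m, rfl⟩ : K = 0 ∨ ∃ m, K = 1 + m := by
        rcases K with _ | m
        · exact Or.inl rfl
        · exact Or.inr ⟨m, Nat.add_comm m 1⟩
      · exact absurd h hx
      · rw [traj_one_add] at h
        rw [cost_one_add, ENNReal.coe_add]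
        exact iInf_le_of_le (a 0) (add_le_add_right (ih (by omega) h) _)

end Plans

/-- Synchronous value iteration converges to the optimal cost-to-go in at most
`|X|` sweeps. -/
theorem valIter_converges [Fintype X] [Fintype U] [Nonempty U]
    (f : X → U → X) (ℓ : X → U → ℝ≥0) (G : Set X) :
    ∀ n ≥ Fintype.card X, (valIter f ℓ G)^[n] (Vinit G) = Gstar f ℓ G := by
  intro n hn
  funext x
  refine le_antisymm ?_ (Gstar_le_iterate f ℓ G n x)
  refine le_iInf fun K => le_iInf fun a => le_iInf fun h => ?_
  obtain ⟨L, b, hL, hbt, hbc⟩ := exists_plan_lt_card f ℓ x a K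
  exact (iterate_le_cost f ℓ G n (hL.le.trans hn) (hbt ▸ h)).trans (ENNReal.coe_le_coe.mpr hbc)
end

section
/- In a deterministic planning problem, define the value-iteration operator T : (X → ℝ≥0∞) → (X → ℝ≥0∞) by (T V) x = 0 if x ∈ G and (T V) x = ⨅ (u : U), ((ℓ x u : ℝ≥0∞) + V (f x u)) if x ∉ G. Let V₀ : X → ℝ≥0∞ be V₀ x = 0 for x ∈ G and V₀ x = ⊤ otherwise, let z : ℕ → X be an update schedule in which every state occurs infinitely often (∀ x, ∀ n, ∃ k ≥ n, z k = x), and define the asynchronous iterates by V_{k+1} y = (T V_k) y if y = z k and V_{k+1} y = V_k y otherwise. Then there exists K : ℕ such that for all k ≥ K, V_k = G*; that is, asynchronous single-state value iteration with a fair schedule reaches the optimal cost-to-go after finitely many updates and remains there. -/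
open scoped NNReal ENNReal

variable {X U : Type*}

theorem traj_succ_left (f : X → U → X) (x : X) (a : ℕ → U) (k : ℕ) :
    traj f x a (k + 1) = traj f (f x (a 0)) (fun n => a (n + 1)) k := by
  induction k with
  | zero => rfl
  | succ k ih => rw [traj, ih, traj]

theorem cost_succ_left (f : X → U → X) (ℓ : X → U → ℝ≥0) (x : X) (a : ℕ → U) (k : ℕ) :
    cost f ℓ x a (k + 1) = ℓ x (a 0) + cost f ℓ (f x (a 0)) (fun n => a (n + 1)) k := by
  simp only [cost, Finset.sum_range_succ', traj_succ_left, add_comm]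
  rfl

/-- The costs of goal-reaching plans from `x`, together with `⊤`. -/
def planCosts (f : X → U → X) (ℓ : X → U → ℝ≥0) (G : Set X) (x : X) : Set ℝ≥0∞ :=
  insert ⊤ {c | ∃ (K : ℕ) (a : ℕ → U), traj f x a K ∈ G ∧ c = (cost f ℓ x a K : ℝ≥0∞)}

theorem Gstar_le_of_mem_planCosts {f : X → U → X} {ℓ : X → U → ℝ≥0} {G : Set X} {x : X}
    {c : ℝ≥0∞} (hc : c ∈ planCosts f ℓ G x) : Gstar f ℓ G x ≤ c := by
  rcases hc with rfl | ⟨K, a, h, rfl⟩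
  · exact le_top
  · exact iInf_le_of_le K (iInf₂_le a h)

theorem zero_mem_planCosts [Nonempty U] (f : X → U → X) (ℓ : X → U → ℝ≥0) {G : Set X} {x : X}
    (hx : x ∈ G) : 0 ∈ planCosts f ℓ G x :=
  Or.inr ⟨0, fun _ => Classical.arbitrary U, hx, by simp [cost]⟩

theorem add_mem_planCosts {f : X → U → X} {ℓ : X → U → ℝ≥0} {G : Set X} {x : X} {u : U}
    {c : ℝ≥0∞} (hc : c ∈ planCosts f ℓ G (f x u)) : ℓ x u + c ∈ planCosts f ℓ G x := by
  rcases hc with rfl | ⟨K, a, h, rfl⟩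
  · exact Or.inl (add_top _)
  · let b : ℕ → U := fun n => Nat.casesOn n u a
    refine Or.inr ⟨K + 1, b, ?_, ?_⟩
    · rw [traj_succ_left]
      exact h
    · rw [cost_succ_left, ENNReal.coe_add]
      rfl

theorem isWF_planCosts [Finite X] [Finite U] (f : X → U → X) (ℓ : X → U → ℝ≥0) (G : Set X)
    (x : X) : (planCosts f ℓ G x).IsWF := by
  let s : Set ℝ≥0 := Set.range fun p : X × U => ℓ p.1 p.2
  have hs : (AddSubmonoid.closure s : Set ℝ≥0).IsPWO :=
    Set.IsPWO.addSubmonoid_closure (fun _ _ => zero_le) (Set.finite_range _).isPWO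
  have hs' := (hs.image_of_monotone ENNReal.coe_mono).insert ⊤
  refine hs'.isWF.mono (Set.insert_subset_insert ?_)
  rintro _ ⟨K, a, -, rfl⟩
  exact ⟨_, sum_mem fun k _ => AddSubmonoid.subset_closure ⟨(traj f x a k, a k), rfl⟩, rfl⟩

theorem valIter_mono (f : X → U → X) (ℓ : X → U → ℝ≥0) (G : Set X) :
    Monotone (valIter f ℓ G) := by
  intro V W h x
  unfold valIter
  split_ifs
  · exact le_rfl
  · exact iInf_mono fun u => add_le_add_right (h _) _

theorem valIter_Vinit_le (f : X → U → X) (ℓ : X → U → ℝ≥0) (G : Set X) :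
    valIter f ℓ G (Vinit G) ≤ Vinit G := by
  intro x
  by_cases hx : x ∈ G <;> simp [valIter, Vinit, hx]

theorem Vinit_mem_planCosts [Nonempty U] (f : X → U → X) (ℓ : X → U → ℝ≥0) (G : Set X)
    (x : X) : Vinit G x ∈ planCosts f ℓ G x := by
  unfold Vinit
  split_ifs with hx
  · exact zero_mem_planCosts f ℓ hx
  · exact Or.inl rfl

theorem valIter_mem_planCosts [Finite U] [Nonempty U] {f : X → U → X} {ℓ : X → U → ℝ≥0}
    {G : Set X} {V : X → ℝ≥0∞} (hV : ∀ x, V x ∈ planCosts f ℓ G x) (x : X) :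
    valIter f ℓ G V x ∈ planCosts f ℓ G x := by
  unfold valIter
  split_ifs with hx
  · exact zero_mem_planCosts f ℓ hx
  · obtain ⟨u, hu⟩ := exists_eq_ciInf_of_finite (f := fun u => (ℓ x u : ℝ≥0∞) + V (f x u))
    rw [← hu]
    exact add_mem_planCosts (hV _)

theorem le_Gstar_of_le_valIter {f : X → U → X} {ℓ : X → U → ℝ≥0} {G : Set X}
    {V : X → ℝ≥0∞} (hV : V ≤ valIter f ℓ G V) : V ≤ Gstar f ℓ G := by
  have hgoal : ∀ x ∈ G, V x = 0 := fun x hx =>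
    le_antisymm ((hV x).trans_eq (if_pos hx)) zero_le
  suffices h : ∀ (K : ℕ) (x : X) (a : ℕ → U), traj f x a K ∈ G → V x ≤ cost f ℓ x a K from
    fun x => le_iInf fun K => le_iInf₂ fun a ha => h K x a ha
  intro K
  induction K with
  | zero => exact fun x a h => (hgoal x h).trans_le zero_le
  | succ K ih =>
    intro x a h
    by_cases hx : x ∈ G
    · exact (hgoal x hx).trans_le zero_le
    rw [traj_succ_left] at h
    rw [cost_succ_left, ENNReal.coe_add]
    calc V x ≤ ⨅ u, ((ℓ x u : ℝ≥0∞) + V (f x u)) := (hV x).trans_eq (if_neg hx)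
      _ ≤ ℓ x (a 0) + V (f x (a 0)) := iInf_le _ _
      _ ≤ _ := add_le_add_right (ih _ _ h) _

theorem Antitone.eventually_const_of_isWF {α : Type*} [LinearOrder α] {v : ℕ → α}
    (hv : Antitone v) {s : Set α} (hs : s.IsWF) (hmem : ∀ k, v k ∈ s) :
    ∃ K, ∀ k ≥ K, v k = v K := by
  have hr : (Set.range v).IsWF := hs.mono (Set.range_subset_iff.2 hmem)
  obtain ⟨K, hK⟩ := hr.min_mem (Set.range_nonempty v)
  exact ⟨K, fun k hk => le_antisymm (hv hk) (hK.trans_le (hr.min_le _ ⟨k, rfl⟩))⟩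

open Classical in
/-- Asynchronous single-state value iteration with a fair update schedule reaches
the optimal cost-to-go after finitely many updates and remains there. -/
theorem async_valIter_converges [Fintype X] [Fintype U] [Nonempty U]
    (f : X → U → X) (ℓ : X → U → ℝ≥0) (G : Set X)
    (z : ℕ → X) (hz : ∀ x : X, ∀ n : ℕ, ∃ k ≥ n, z k = x)
    (V : ℕ → X → ℝ≥0∞)
    (hV0 : V 0 = Vinit G)
    (hstep : ∀ k : ℕ, ∀ y : X,
      V (k + 1) y = if y = z k then valIter f ℓ G (V k) y else V k y) :
    ∃ K : ℕ, ∀ k ≥ K, V k = Gstar f ℓ G := by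
  have hmem : ∀ k x, V k x ∈ planCosts f ℓ G x := by
    intro k
    induction k with
    | zero => exact hV0 ▸ Vinit_mem_planCosts f ℓ G
    | succ k ih =>
      intro x
      rw [hstep]
      split_ifs
      · exact valIter_mem_planCosts ih x
      · exact ih x
  have hle_of {k : ℕ} (h : valIter f ℓ G (V k) ≤ V k) : V (k + 1) ≤ V k := by
    intro x
    rw [hstep]
    split_ifs
    · exact h x
    · exact le_rfl
  have hsuper : ∀ k, valIter f ℓ G (V k) ≤ V k := by
    intro k
    induction k with
    | zero => exact hV0 ▸ valIter_Vinit_le f ℓ G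
    | succ k ih =>
      refine (valIter_mono f ℓ G (hle_of ih)).trans fun x => ?_
      rw [hstep]
      split_ifs
      · exact le_rfl
      · exact ih x
  have hanti : Antitone V := antitone_nat_of_succ_le fun k => hle_of (hsuper k)
  choose N hN using fun x => Antitone.eventually_const_of_isWF
    (fun _ _ h => hanti h x : Antitone fun k => V k x) (isWF_planCosts f ℓ G x) (hmem · x)
  let K := Finset.univ.sup N
  have hK : ∀ k ≥ K, V k = V K := fun k hk => funext fun x => by
    have hx : N x ≤ K := Finset.le_sup (Finset.mem_univ x)
    exact (hN x k (hx.trans hk)).trans (hN x K hx).symm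
  refine ⟨K, fun k hk => (hK k hk).trans (le_antisymm (le_Gstar_of_le_valIter fun x => ?_)
    fun x => Gstar_le_of_mem_planCosts (hmem K x))⟩
  obtain ⟨m, hm, rfl⟩ := hz x K
  have h := hstep m (z m)
  rw [if_pos rfl, hK m hm, hK (m + 1) (Nat.le_succ_of_le hm)] at h
  exact h.le
end
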